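/- (Cauchy theorem for λ-slice monogenic functions.) Let λ ∈ ℝ, let U ⊆ ℝ^{n+1} be an axially symmetric s-domain, let f ∈ SM_λ(U), let I ∈ 𝕊, and let γ : [0,1] → U_I be a closed piecewise-C¹ curve which is homotopic to a constant curve within U_I. Then ∫_0^1 e^{λ Re γ(t)} γ′(t) (−I) f(γ(t)) dt = 0. -/

import Mathlib

open scoped BigOperators
open Set

noncomputable section

/-- The sphere 𝕊 of (coefficient vectors of) unit 1-vectors in ℝⁿ. -/
def USphere (n : ℕ) : Set (Fin n → ℝ) := {x | ∑ i, x i ^ 2 = 1}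

/-- Points of ℝ^{n+1}, written as (x₀, (x₁, …, xₙ)). -/
abbrev Pt (n : ℕ) := ℝ × (Fin n → ℝ)

variable {n : ℕ} {Cl : Type} [NormedRing Cl] [NormedAlgebra ℝ Cl]

/-- The 1-vector of the Clifford algebra with coefficients `x` w.r.t. generators `e`. -/
def vecEmb (e : Fin n → Cl) (x : Fin n → ℝ) : Cl := ∑ i, x i • e i

/-- The defining relations `eᵢeⱼ + eⱼeᵢ = -2δᵢⱼ` of the Clifford algebra ℝₙ. -/
def CliffordRel (e : Fin n → Cl) : Prop :=
  ∀ i j, e i * e j + e j * e i = if i = j then (-2 : Cl) else 0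

/-- The slice Cauchy–Riemann operator `(∂/∂u + I ∂/∂v)` applied to the restriction of `f`
to the slice `ℂ_I`, `I = vecEmb e x`, evaluated at the point `u + I v`. -/
def sliceCR (e : Fin n → Cl) (f : Pt n → Cl) (x : Fin n → ℝ) (u v : ℝ) : Cl :=
  deriv (fun t => f (t, v • x)) u + vecEmb e x * deriv (fun t => f (u, t • x)) v

/-- λ-slice monogenic functions on `U`. -/
def SMlam (e : Fin n → Cl) (lam : ℝ) (U : Set (Pt n)) (f : Pt n → Cl) : Prop :=
  ContDiffOn ℝ 1 f U ∧
  ∀ x ∈ USphere n, ∀ u v : ℝ, ((u, v • x) : Pt n) ∈ U →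
    sliceCR e f x u v + lam • f (u, v • x) = 0

/-- The coordinates (u,v) of the slice `U_I = U ∩ ℂ_I`, `I = vecEmb e x`. -/
def SlicePre (n : ℕ) (U : Set (Pt n)) (x : Fin n → ℝ) : Set (ℝ × ℝ) :=
  {p | ((p.1, p.2 • x) : Pt n) ∈ U}

/-- Axially symmetric slice domains in ℝ^{n+1}. -/
def AxSymSDomain (n : ℕ) (U : Set (Pt n)) : Prop :=
  IsOpen U ∧ IsConnected U ∧ (∃ u : ℝ, ((u, (0 : Fin n → ℝ)) : Pt n) ∈ U) ∧
  (∀ x ∈ USphere n, IsConnected (SlicePre n U x)) ∧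
  ∀ x ∈ USphere n, ∀ y ∈ USphere n, ∀ u v : ℝ,
    ((u, v • x) : Pt n) ∈ U → ((u, v • y) : Pt n) ∈ U

/-- A holomorphic function with values in `ℂ_I`, `I = vecEmb e x`, on a
(relatively open) coordinate set `V`. -/
def SliceHolo (e : Fin n → Cl) (x : Fin n → ℝ) (V : Set (ℝ × ℝ)) (F : ℝ × ℝ → Cl) : Prop :=
  DifferentiableOn ℝ F V ∧
  (∀ p ∈ V, ∃ a b : ℝ, F p = algebraMap ℝ Cl a + b • vecEmb e x) ∧
  ∀ p ∈ V, deriv (fun t => F (t, p.2)) p.1 + vecEmb e x * deriv (fun t => F (p.1, t)) p.2 = 0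

/-- Ordered product `I_A = I_{i₁} ⋯ I_{i_k}` over a finite index set `A`. -/
def IAprod (e : Fin n → Cl) (J : Fin n → Fin n → ℝ) (A : Finset (Fin n)) : Cl :=
  ((A.sort (· ≤ ·)).map fun i => vecEmb e (J i)).prod

/-- A closed piecewise-C¹ curve parametrized on [0,1]. -/
def PiecewiseC1 (γ : ℝ → ℝ × ℝ) : Prop :=
  ContinuousOn γ (Icc 0 1) ∧
  ∃ (k : ℕ) (t : Fin (k + 1) → ℝ), t 0 = 0 ∧ t (Fin.last k) = 1 ∧ StrictMono t ∧
    ∀ i : Fin k, ContDiffOn ℝ 1 γ (Icc (t i.castSucc) (t i.succ))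

/-- `γ` is a closed curve in `V`, homotopic within `V` to a constant curve. -/
def NullHomotopicIn (γ : ℝ → ℝ × ℝ) (V : Set (ℝ × ℝ)) : Prop :=
  γ 0 = γ 1 ∧ (∀ t ∈ Icc (0:ℝ) 1, γ t ∈ V) ∧
  ∃ (H : ℝ × ℝ → ℝ × ℝ) (p : ℝ × ℝ),
    ContinuousOn H (Icc 0 1 ×ˢ Icc 0 1) ∧
    (∀ q ∈ (Icc (0:ℝ) 1 ×ˢ Icc (0:ℝ) 1), H q ∈ V) ∧
    (∀ t ∈ Icc (0:ℝ) 1, H (0, t) = γ t) ∧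
    (∀ t ∈ Icc (0:ℝ) 1, H (1, t) = p) ∧
    (∀ s ∈ Icc (0:ℝ) 1, H (s, 0) = H (s, 1))

/-- The inverse `(a + bI)⁻¹` computed in the field `ℂ_I`, `I = vecEmb e x`. -/
def sliceInv (e : Fin n → Cl) (x : Fin n → ℝ) (a b : ℝ) : Cl :=
  (a ^ 2 + b ^ 2)⁻¹ • (algebraMap ℝ Cl a - b • vecEmb e x)

/-- The closed Euclidean ball of ℝ^{n+1}. -/
def EucClosedBall (y : Pt n) (ρ : ℝ) : Set (Pt n) :=
  {p | (p.1 - y.1) ^ 2 + ∑ i, (p.2 i - y.2 i) ^ 2 ≤ ρ ^ 2}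

/-- Left fractional integral of order `σ` with respect to `g` (with derivative `g'`),
with base point `aa`. -/
def fracInt (aa σ : ℝ) (g g' : ℝ → ℝ) (φ : ℝ → Cl) (u : ℝ) : Cl :=
  (Real.Gamma σ)⁻¹ • ∫ τ in aa..u, ((g u - g τ) ^ (σ - 1) * g' τ) • φ τ

/-- Right fractional integral of order `σ` with respect to `h` (with derivative `h'`),
with base point `cc`. -/
def fracIntR (cc σ : ℝ) (h h' : ℝ → ℝ) (φ : ℝ → Cl) (v : ℝ) : Cl :=
  (Real.Gamma σ)⁻¹ • ∫ τ in v..cc, ((h τ - h v) ^ (σ - 1) * h' τ) • φ τ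

/-- Left Riemann–Liouville fractional derivative of order `al` w.r.t. `g` on `[aa, bb]`
(one-sided derivatives at the endpoints). -/
def rlD (aa bb al : ℝ) (g g' : ℝ → ℝ) (φ : ℝ → Cl) (u : ℝ) : Cl :=
  (g' u)⁻¹ • derivWithin (fracInt aa (1 - al) g g' φ) (Icc aa bb) u

/-- The set `S_{a,b,c} ⊆ ℝ^{n+1}`. -/
def Sabc (n : ℕ) (a b c : ℝ) : Set (Pt n) :=
  {p | ∃ x ∈ USphere n, ∃ u ∈ Icc a b, ∃ v ∈ Icc 0 c, p = ((u, v • x) : Pt n)}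

/-- Absolutely continuous function on `[a,b]`. -/
def AbsContOn {E : Type} [NormedAddCommGroup E] (φ : ℝ → E) (a b : ℝ) : Prop :=
  ∀ ε > (0:ℝ), ∃ δ > (0:ℝ), ∀ (k : ℕ) (p q : Fin k → ℝ),
    (∀ i, p i ∈ Icc a b ∧ q i ∈ Icc a b ∧ p i ≤ q i) →
    (∀ i j, i ≠ j → Ioo (p i) (q i) ∩ Ioo (p j) (q j) = ∅) →
    (∑ i, (q i - p i)) < δ → (∑ i, ‖φ (q i) - φ (p i)‖) < ε

/-- The class `AC¹(S_{a,b,c}, ℝₙ)`. -/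
def AC1 (a b c r s : ℝ) (f : Pt n → Cl) : Prop :=
  ContinuousOn f (Sabc n a b c) ∧
  ∀ x ∈ USphere n,
    AbsContOn (fun u => f (u, s • x)) a b ∧ AbsContOn (fun v => f (r, v • x)) 0 c

/-- `A_I(u) = (I_{a+}^{1-α,g}[τ ↦ f(τ + Is)])(u)`, where `I = vecEmb e x`. -/
def AIfun (a al s : ℝ) (g g' : ℝ → ℝ) (f : Pt n → Cl) (x : Fin n → ℝ) : ℝ → Cl :=
  fracInt a (1 - al) g g' fun τ => f (τ, s • x)

/-- `B_I(v) = (I_{0+}^{1-β,h}[τ ↦ f(r + Iτ)])(v)`, where `I = vecEmb e x`. -/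
def BIfun (be r : ℝ) (h h' : ℝ → ℝ) (f : Pt n → Cl) (x : Fin n → ℝ) : ℝ → Cl :=
  fracInt 0 (1 - be) h h' fun τ => f (r, τ • x)

/-- `B_I^{c-}(v) = (I_{c-}^{1-β,h}[τ ↦ f(r + Iτ)])(v)`, where `I = vecEmb e x`. -/
def BIcfun (c be r : ℝ) (h h' : ℝ → ℝ) (f : Pt n → Cl) (x : Fin n → ℝ) : ℝ → Cl :=
  fracIntR c (1 - be) h h' fun τ => f (r, τ • x)

/-- Condition (m1): the maps `A_I` and `B_I` are of class C¹ for every `I ∈ 𝕊`. -/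
def M1 (a b c al be r s : ℝ) (g g' h h' : ℝ → ℝ) (f : Pt n → Cl) : Prop :=
  ∀ x ∈ USphere n,
    ContDiffOn ℝ 1 (AIfun a al s g g' f x) (Icc a b) ∧
    ContDiffOn ℝ 1 (BIfun be r h h' f x) (Icc 0 c)

/-- Riemann–Liouville fractional slice monogenic functions of order `(α,β)`
with respect to `(g,h)` on `S_{a,b,c}`. -/
def RLSM (a b c al be r s : ℝ) (g g' h h' : ℝ → ℝ) (e : Fin n → Cl) (f : Pt n → Cl) : Prop :=
  AC1 a b c r s f ∧ M1 a b c al be r s g g' h h' f ∧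
  ∀ x ∈ USphere n, ∀ u ∈ Icc a b, ∀ v ∈ Icc 0 c,
    (g' u)⁻¹ • derivWithin (AIfun a al s g g' f x) (Icc a b) u +
      vecEmb e x * ((h' v)⁻¹ • derivWithin (BIfun be r h h' f x) (Icc 0 c) v) = 0


/-- Moving a closed polygon across a grid of squares, each of which contributes nothing, does not
change the sum of `L` over its edges. -/
lemma sum_edges_eq_of_grid {E F : Type*} [AddCommGroup F] (L : E → E → F) (P : ℕ → ℕ → E) (N : ℕ)
    (hsq : ∀ i < N, ∀ j < N, L (P i j) (P i (j + 1)) + L (P i (j + 1)) (P (i + 1) (j + 1)) =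
      L (P i j) (P (i + 1) j) + L (P (i + 1) j) (P (i + 1) (j + 1)))
    (hcl : ∀ i ≤ N, P i 0 = P i N) :
    ∑ j ∈ Finset.range N, L (P 0 j) (P 0 (j + 1)) =
      ∑ j ∈ Finset.range N, L (P N j) (P N (j + 1)) := by
  have key : ∀ i ≤ N, ∑ j ∈ Finset.range N, L (P 0 j) (P 0 (j + 1)) =
      ∑ j ∈ Finset.range N, L (P i j) (P i (j + 1)) := by
    intro i
    induction i with
    | zero => simp
    | succ i ih =>
      intro hi
      rw [ih (by omega), ← sub_eq_zero, ← Finset.sum_sub_distrib]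
      have h : ∀ j ∈ Finset.range N,
          L (P i j) (P i (j + 1)) - L (P (i + 1) j) (P (i + 1) (j + 1)) =
          L (P i j) (P (i + 1) j) - L (P i (j + 1)) (P (i + 1) (j + 1)) := by
        intro j hj
        rw [sub_eq_sub_iff_add_eq_add, hsq i (by omega) j (Finset.mem_range.1 hj)]
      rw [Finset.sum_congr rfl h, Finset.sum_range_sub' fun j => L (P i j) (P (i + 1) j),
        hcl i (by omega), hcl (i + 1) hi, sub_self]
  exact key N le_rfl

/-- A continuous map on the unit square with values in an open set `V` maps each square of a fine
enough grid into a ball contained in `V`. -/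
lemma exists_grid_subset_ball {E : Type*} [SeminormedAddCommGroup E] {V : Set E}
    (hV : IsOpen V) {H : ℝ × ℝ → E}
    (hH : ContinuousOn H (Icc 0 1 ×ˢ Icc 0 1)) (hHV : MapsTo H (Icc 0 1 ×ˢ Icc 0 1) V) :
    ∃ N : ℕ, 0 < N ∧ ∀ i < N, ∀ j < N, ∃ c r, Metric.ball c r ⊆ V ∧
      MapsTo H (Icc ((i : ℝ) / N) ((i + 1 : ℕ) / N) ×ˢ Icc ((j : ℝ) / N) ((j + 1 : ℕ) / N))
        (Metric.ball c r) := by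
  have hK : IsCompact (Icc (0 : ℝ) 1 ×ˢ Icc (0 : ℝ) 1) := isCompact_Icc.prod isCompact_Icc
  obtain ⟨ε, hε, hεV⟩ := (hK.image_of_continuousOn hH).exists_thickening_subset_open hV
    hHV.image_subset
  obtain ⟨δ, hδ, hδH⟩ := Metric.uniformContinuousOn_iff.1
    (hK.uniformContinuousOn_of_continuous hH) ε hε
  obtain ⟨M, hM⟩ := exists_nat_one_div_lt hδ
  refine ⟨M + 1, M.succ_pos, fun i hi j hj => ?_⟩
  have hN : (0 : ℝ) < (M + 1 : ℕ) := by positivity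
  have hsub : ∀ k < M + 1, Icc ((k : ℝ) / (M + 1 : ℕ)) ((k + 1 : ℕ) / (M + 1 : ℕ)) ⊆ Icc 0 1 :=
    fun k hk => Icc_subset_Icc (by positivity)
      ((div_le_one hN).2 (by exact_mod_cast Nat.succ_le_of_lt hk))
  have hle : ∀ k : ℕ, (k : ℝ) / (M + 1 : ℕ) ≤ (k + 1 : ℕ) / (M + 1 : ℕ) := fun k => by
    gcongr; simp
  have hdist : ∀ k : ℕ, ∀ t ∈ Icc ((k : ℝ) / (M + 1 : ℕ)) ((k + 1 : ℕ) / (M + 1 : ℕ)),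
      dist t ((k : ℝ) / (M + 1 : ℕ)) < δ := by
    intro k t ht
    have : ((k + 1 : ℕ) : ℝ) / (M + 1 : ℕ) - k / (M + 1 : ℕ) = 1 / (M + 1) := by
      push_cast; ring
    rw [Real.dist_eq, abs_of_nonneg (sub_nonneg.2 ht.1)]
    linarith [ht.2]
  have hcorner : ((i : ℝ) / (M + 1 : ℕ), (j : ℝ) / (M + 1 : ℕ)) ∈ Icc (0 : ℝ) 1 ×ˢ Icc (0 : ℝ) 1 :=
    ⟨hsub i hi (left_mem_Icc.2 (hle i)), hsub j hj (left_mem_Icc.2 (hle j))⟩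
  refine ⟨H ((i : ℝ) / (M + 1 : ℕ), (j : ℝ) / (M + 1 : ℕ)), ε, fun p hp => hεV ?_, fun q hq => ?_⟩
  · exact Metric.mem_thickening_iff.2 ⟨_, mem_image_of_mem H hcorner, hp⟩
  · exact hδH q ⟨hsub i hi hq.1, hsub j hj hq.2⟩ _ hcorner
      (max_lt (hdist i _ hq.1) (hdist j _ hq.2))

section ClosedForm

variable {E F : Type*} [NormedAddCommGroup E] [NormedSpace ℝ E] [NormedAddCommGroup F]
  [NormedSpace ℝ F] {ω : E → E →L[ℝ] F} {V B : Set E}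

lemma curveIntegral_segment_add_of_closed (hB : Convex ℝ B) (hBo : IsOpen B)
    (hω : DifferentiableOn ℝ ω B) (hsymm : ∀ p ∈ B, ∀ u v, fderiv ℝ ω p u v = fderiv ℝ ω p v u)
    {a b c : E} (ha : a ∈ B) (hb : b ∈ B) (hc : c ∈ B) :
    curveIntegral ω (.segment a b) + curveIntegral ω (.segment b c) =
      curveIntegral ω (.segment a c) :=
  hB.curveIntegral_segment_add_eq_of_hasFDerivWithinAt_symmetric
    (fun _ hp => (hω.differentiableAt (hBo.mem_nhds hp)).hasFDerivAt.hasFDerivWithinAt)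
    (fun p hp u _ v _ => hsymm p hp u v) ha hb hc

lemma hasFDerivAt_curveIntegral_segment_of_closed [CompleteSpace F] (hB : Convex ℝ B)
    (hBo : IsOpen B) (hω : DifferentiableOn ℝ ω B)
    (hsymm : ∀ p ∈ B, ∀ u v, fderiv ℝ ω p u v = fderiv ℝ ω p v u)
    {a b : E} (ha : a ∈ B) (hb : b ∈ B) :
    HasFDerivAt (fun p => curveIntegral ω (.segment a p)) (ω b) b :=
  (hB.hasFDerivWithinAt_curveIntegral_segment_of_hasFDerivWithinAt_symmetric
    (fun _ hp => (hω.differentiableAt (hBo.mem_nhds hp)).hasFDerivAt.hasFDerivWithinAt)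
    (fun p hp u _ v _ => hsymm p hp u v) ha hb).hasFDerivAt (hBo.mem_nhds hb)

/-- Along a curve staying in a convex open set, the integral of a closed form is the integral over
the segment joining the endpoints. -/
lemma integral_eq_curveIntegral_segment [CompleteSpace F] (hB : Convex ℝ B)
    (hBo : IsOpen B) (hω : DifferentiableOn ℝ ω B)
    (hsymm : ∀ p ∈ B, ∀ u v, fderiv ℝ ω p u v = fderiv ℝ ω p v u)
    {γ : ℝ → E} {a b : ℝ} (hab : a ≤ b) {s : Set ℝ} (hs : s.Countable)
    (hγ : ContinuousOn γ (Icc a b)) (hγB : MapsTo γ (Icc a b) B)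
    (hd : ∀ t ∈ Ioo a b \ s, DifferentiableAt ℝ γ t)
    (hint : IntervalIntegrable (fun t => ω (γ t) (deriv γ t)) MeasureTheory.volume a b) :
    ∫ t in a..b, ω (γ t) (deriv γ t) = curveIntegral ω (.segment (γ a) (γ b)) := by
  have hF : ∀ p ∈ B, HasFDerivAt (fun p => curveIntegral ω (.segment (γ a) p)) (ω p) p :=
    fun p hp => hasFDerivAt_curveIntegral_segment_of_closed hB hBo hω hsymm
      (hγB (left_mem_Icc.2 hab)) hp
  rw [MeasureTheory.integral_eq_of_hasDerivAt_off_countable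
    (fun t => curveIntegral ω (.segment (γ a) (γ t))) _ hs _ _ hint]
  · simp
  · rw [uIcc_of_le hab]
    intro t ht
    exact (hF _ (hγB ht)).continuousAt.comp_continuousWithinAt (hγ t ht)
  · rw [min_eq_left hab, max_eq_right hab]
    intro t ht
    exact (hF _ (hγB (Ioo_subset_Icc_self ht.1))).comp_hasDerivAt t (hd t ht).hasDerivAt

/-- The integral of a closed form over a null-homotopic closed curve vanishes. -/
theorem integral_closed_form_eq_zero_of_homotopy [CompleteSpace F] (hV : IsOpen V)
    (hω : DifferentiableOn ℝ ω V) (hsymm : ∀ p ∈ V, ∀ u v, fderiv ℝ ω p u v = fderiv ℝ ω p v u)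
    {γ : ℝ → E} {s : Set ℝ} (hs : s.Countable) (hγ : ContinuousOn γ (Icc 0 1))
    (hd : ∀ t ∈ Ioo (0 : ℝ) 1 \ s, DifferentiableAt ℝ γ t)
    (hint : IntervalIntegrable (fun t => ω (γ t) (deriv γ t)) MeasureTheory.volume 0 1)
    {H : ℝ × ℝ → E} {p : E} (hH : ContinuousOn H (Icc 0 1 ×ˢ Icc 0 1))
    (hHV : MapsTo H (Icc 0 1 ×ˢ Icc 0 1) V) (hH0 : ∀ t ∈ Icc (0 : ℝ) 1, H (0, t) = γ t)
    (hH1 : ∀ t ∈ Icc (0 : ℝ) 1, H (1, t) = p)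
    (hHcl : ∀ σ ∈ Icc (0 : ℝ) 1, H (σ, 0) = H (σ, 1)) :
    ∫ t in (0 : ℝ)..1, ω (γ t) (deriv γ t) = 0 := by
  obtain ⟨N, hN, hgrid⟩ := exists_grid_subset_ball hV hH hHV
  have hN' : (0 : ℝ) < N := by exact_mod_cast hN
  have hmem : ∀ k ≤ N, (k : ℝ) / N ∈ Icc (0 : ℝ) 1 := fun k hk =>
    ⟨by positivity, (div_le_one hN').2 (by exact_mod_cast hk)⟩
  have hle : ∀ k : ℕ, (k : ℝ) / N ≤ (k + 1 : ℕ) / N := fun k => by gcongr; simp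
  have hsub : ∀ k < N, Icc ((k : ℝ) / N) ((k + 1 : ℕ) / N) ⊆ Icc 0 1 := fun k hk =>
    Icc_subset_Icc (hmem k hk.le).1 (hmem (k + 1) hk).2
  have hint' : ∀ k < N, IntervalIntegrable (fun t => ω (γ t) (deriv γ t)) MeasureTheory.volume
      ((k : ℝ) / N) ((k + 1 : ℕ) / N) := fun k hk => hint.mono_set (by
    rw [uIcc_of_le (hle k), uIcc_of_le zero_le_one]; exact hsub k hk)
  have hpiece : ∀ k < N, ∫ t in ((k : ℝ) / N)..((k + 1 : ℕ) / N), ω (γ t) (deriv γ t) =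
      curveIntegral ω (.segment (H ((0 : ℕ) / N, (k : ℝ) / N))
        (H ((0 : ℕ) / N, (k + 1 : ℕ) / N))) := by
    intro k hk
    obtain ⟨c, r, hcV, hc⟩ := hgrid 0 hN k hk
    have h0 : ((0 : ℕ) : ℝ) / N = 0 := by simp
    rw [h0, hH0 _ (hmem k hk.le), hH0 _ (hmem (k + 1) hk)]
    refine integral_eq_curveIntegral_segment (convex_ball c r) Metric.isOpen_ball (hω.mono hcV)
      (fun p hp => hsymm p (hcV hp)) (hle k) hs (hγ.mono (hsub k hk)) (fun t ht => ?_)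
      (fun t ht => hd t ⟨?_, ht.2⟩) (hint' k hk)
    · rw [← hH0 t (hsub k hk ht)]
      exact hc ⟨⟨h0.le, by positivity⟩, ht⟩
    · exact ⟨(hmem k hk.le).1.trans_lt ht.1.1, ht.1.2.trans_le (hmem (k + 1) hk).2⟩
  have hsum := intervalIntegral.sum_integral_adjacent_intervals
    (a := fun k : ℕ => (k : ℝ) / N) hint'
  simp only [Nat.cast_zero, zero_div, div_self hN'.ne'] at hsum
  rw [← hsum, Finset.sum_congr rfl fun k hk => hpiece k (Finset.mem_range.1 hk),
    sum_edges_eq_of_grid (fun a b => curveIntegral ω (.segment a b))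
      (fun i j => H ((i : ℝ) / N, (j : ℝ) / N)) N]
  · refine Finset.sum_eq_zero fun j hj => ?_
    have hj := Finset.mem_range.1 hj
    rw [div_self hN'.ne', hH1 _ (hmem j hj.le), hH1 _ (hmem (j + 1) hj)]
    simp
  · intro i hi j hj
    obtain ⟨c, r, hcV, hc⟩ := hgrid i hi j hj
    have htri : ∀ {a b d : E}, a ∈ Metric.ball c r → b ∈ Metric.ball c r → d ∈ Metric.ball c r →
        curveIntegral ω (.segment a b) + curveIntegral ω (.segment b d) =
          curveIntegral ω (.segment a d) := fun ha hb hd =>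
      curveIntegral_segment_add_of_closed (convex_ball c r) Metric.isOpen_ball (hω.mono hcV)
        (fun p hp => hsymm p (hcV hp)) ha hb hd
    have hl : ∀ k : ℕ, (k : ℝ) / N ∈ Icc ((k : ℝ) / N) ((k + 1 : ℕ) / N) :=
      fun k => left_mem_Icc.2 (hle k)
    have hr : ∀ k : ℕ, ((k + 1 : ℕ) : ℝ) / N ∈ Icc ((k : ℝ) / N) ((k + 1 : ℕ) / N) :=
      fun k => right_mem_Icc.2 (hle k)
    rw [htri (hc ⟨hl i, hl j⟩) (hc ⟨hl i, hr j⟩) (hc ⟨hr i, hr j⟩),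
      htri (hc ⟨hl i, hl j⟩) (hc ⟨hr i, hl j⟩) (hc ⟨hr i, hr j⟩)]
  · intro i hi
    simpa [div_self hN'.ne'] using hHcl _ (hmem i hi)

end ClosedForm

lemma PiecewiseC1.exists_partition {γ : ℝ → ℝ × ℝ} (hγ : PiecewiseC1 γ) :
    ∃ (k : ℕ) (a : ℕ → ℝ), a 0 = 0 ∧ a k = 1 ∧
      ∀ i < k, a i < a (i + 1) ∧ ContDiffOn ℝ 1 γ (Icc (a i) (a (i + 1))) := by
  obtain ⟨-, k, t, h0, h1, hmono, hC⟩ := hγ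
  refine ⟨k, fun i => t (Fin.ofNat (k + 1) i), by simpa using h0, ?_, fun i hi => ?_⟩
  · rw [← h1]
    exact congrArg t (Fin.ext (by simp))
  · have e1 : Fin.ofNat (k + 1) i = (⟨i, hi⟩ : Fin k).castSucc := by
      ext; simp [Nat.mod_eq_of_lt (show i < k + 1 by omega)]
    have e2 : Fin.ofNat (k + 1) (i + 1) = (⟨i, hi⟩ : Fin k).succ := by
      ext; simp [hi]
    simp only [e1, e2]
    exact ⟨hmono Fin.castSucc_lt_succ, hC _⟩

lemma PiecewiseC1.exists_countable_differentiableAt {γ : ℝ → ℝ × ℝ} (hγ : PiecewiseC1 γ) :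
    ∃ s : Set ℝ, s.Countable ∧ ∀ t ∈ Ioo (0 : ℝ) 1 \ s, DifferentiableAt ℝ γ t := by
  obtain ⟨k, a, h0, h1, ha⟩ := hγ.exists_partition
  refine ⟨range a, countable_range a, fun t ⟨ht, hta⟩ => ?_⟩
  have find : ∀ m ≤ k, t < a m → ∃ i < k, a i < t ∧ t < a (i + 1) := by
    intro m
    induction m with
    | zero => intro _ h; exact absurd ht.1 (by rw [h0] at h; exact h.not_gt)
    | succ m ih =>
      intro hm h
      rcases lt_trichotomy t (a m) with h' | h' | h'
      · exact ih (by omega) h'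
      · exact absurd ⟨m, h'.symm⟩ hta
      · exact ⟨m, hm, h', h⟩
  obtain ⟨i, hi, hl, hr⟩ := find k le_rfl (h1 ▸ ht.2)
  exact ((ha i hi).2.differentiableOn one_ne_zero).differentiableAt (Icc_mem_nhds hl hr)

lemma PiecewiseC1.intervalIntegrable_clm_deriv {F : Type*} [NormedAddCommGroup F]
    [NormedSpace ℝ F] {γ : ℝ → ℝ × ℝ} (hγ : PiecewiseC1 γ) {c : ℝ → ℝ × ℝ →L[ℝ] F}
    (hc : ContinuousOn c (Icc 0 1)) :
    IntervalIntegrable (fun t => c t (deriv γ t)) MeasureTheory.volume 0 1 := by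
  obtain ⟨k, a, h0, h1, ha⟩ := hγ.exists_partition
  have hmono : ∀ i j, i ≤ j → j ≤ k → a i ≤ a j := by
    intro i j hij
    induction j, hij using Nat.le_induction with
    | base => simp
    | succ j _ ih => intro hj; exact (ih (by omega)).trans (ha j hj).1.le
  rw [← h0, ← h1]
  refine IntervalIntegrable.trans_iterate fun i hi => ?_
  obtain ⟨hlt, hC⟩ := ha i hi
  have hsub : Icc (a i) (a (i + 1)) ⊆ Icc 0 1 := by
    rw [← h0, ← h1]
    exact Icc_subset_Icc (hmono 0 i (by omega) hi.le) (hmono (i + 1) k hi le_rfl)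
  have hcont : ContinuousOn (fun t => c t (derivWithin γ (Icc (a i) (a (i + 1))) t))
      (Icc (a i) (a (i + 1))) :=
    (hc.mono hsub).clm_apply (hC.continuousOn_derivWithin (uniqueDiffOn_Icc hlt) le_rfl)
  refine (hcont.intervalIntegrable_of_Icc hlt.le).congr_ae ?_
  rw [uIoc_of_le hlt.le, ← MeasureTheory.Measure.restrict_congr_set MeasureTheory.Ioo_ae_eq_Ioc]
  filter_upwards [MeasureTheory.ae_restrict_mem measurableSet_Ioo] with t ht
  rw [derivWithin_of_mem_nhds (Icc_mem_nhds ht.1 ht.2)]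

lemma CliffordRel.vecEmb_mul_self {e : Fin n → Cl} (he : CliffordRel e) {x : Fin n → ℝ}
    (hx : x ∈ USphere n) : vecEmb e x * vecEmb e x = -1 := by
  have h2 : (2 : ℝ) • (vecEmb e x * vecEmb e x) = (2 : ℝ) • (-1 : Cl) := by
    have hexp : vecEmb e x * vecEmb e x = ∑ i, ∑ j, (x i * x j) • (e i * e j) := by
      simp only [vecEmb, Finset.sum_mul_sum, smul_mul_smul_comm]
    calc (2 : ℝ) • (vecEmb e x * vecEmb e x)
        = ∑ i, ∑ j, (x i * x j) • (e i * e j + e j * e i) := by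
          simp only [smul_add, Finset.sum_add_distrib]
          rw [two_smul, hexp]
          congr 1
          rw [Finset.sum_comm]
          exact Finset.sum_congr rfl fun i _ => Finset.sum_congr rfl fun j _ => by
            rw [mul_comm (x i)]
      _ = ∑ i, (x i ^ 2) • (-2 : Cl) := by
          refine Finset.sum_congr rfl fun i _ => ?_
          simp [he i, sq]
      _ = (2 : ℝ) • (-1 : Cl) := by
          rw [← Finset.sum_smul, show ∑ i, x i ^ 2 = 1 from hx, one_smul, two_smul]
          norm_num
  exact smul_right_injective Cl (two_ne_zero (α := ℝ)) h2

/-- The `Cl`-valued form `(du + dv J)(-J) g`, for `J² = -1`. -/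
def sliceForm (J : Cl) (g : ℝ × ℝ → Cl) (p : ℝ × ℝ) : ℝ × ℝ →L[ℝ] Cl :=
  ContinuousLinearMap.smulRightL ℝ (ℝ × ℝ) Cl (ContinuousLinearMap.fst ℝ ℝ ℝ) (-J * g p) +
    ContinuousLinearMap.smulRightL ℝ (ℝ × ℝ) Cl (ContinuousLinearMap.snd ℝ ℝ ℝ) (g p)

lemma sliceForm_apply (J : Cl) (g : ℝ × ℝ → Cl) (p w : ℝ × ℝ) :
    sliceForm J g p w = w.1 • (-J * g p) + w.2 • g p := by
  simp [sliceForm]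

lemma HasFDerivAt.sliceForm {J : Cl} {g : ℝ × ℝ → Cl} {g' : ℝ × ℝ →L[ℝ] Cl} {p : ℝ × ℝ}
    (hg : HasFDerivAt g g' p) :
    HasFDerivAt (sliceForm J g)
      (ContinuousLinearMap.smulRightL ℝ (ℝ × ℝ) Cl (ContinuousLinearMap.fst ℝ ℝ ℝ) ∘L
          (ContinuousLinearMap.mul ℝ Cl (-J) ∘L g') +
        ContinuousLinearMap.smulRightL ℝ (ℝ × ℝ) Cl (ContinuousLinearMap.snd ℝ ℝ ℝ) ∘L g') p :=
  ((ContinuousLinearMap.hasFDerivAt _).comp p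
    ((ContinuousLinearMap.mul ℝ Cl (-J)).hasFDerivAt.comp p hg)).add
    ((ContinuousLinearMap.hasFDerivAt _).comp p hg)

lemma fderiv_sliceForm_symmetric {J : Cl} (hJ : J * J = -1) {g : ℝ × ℝ → Cl} {p : ℝ × ℝ}
    (hg : DifferentiableAt ℝ g p) (hCR : fderiv ℝ g p (1, 0) + J * fderiv ℝ g p (0, 1) = 0)
    (u v : ℝ × ℝ) :
    fderiv ℝ (sliceForm J g) p u v = fderiv ℝ (sliceForm J g) p v u := by
  have hdec : ∀ w : ℝ × ℝ, fderiv ℝ g p w = w.1 • fderiv ℝ g p (1, 0) +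
      w.2 • fderiv ℝ g p (0, 1) := by
    intro w
    rw [← map_smul, ← map_smul, ← map_add]
    simp
  rw [hg.hasFDerivAt.sliceForm.fderiv]
  simp only [add_apply, ContinuousLinearMap.comp_apply,
    ContinuousLinearMap.smulRightL_apply_apply, ContinuousLinearMap.smulRight_apply,
    ContinuousLinearMap.coe_fst', ContinuousLinearMap.coe_snd', ContinuousLinearMap.mul_apply']
  rw [hdec u, hdec v, eq_neg_of_add_eq_zero_left hCR]
  simp only [mul_add, mul_smul_comm, neg_mul, mul_neg, neg_neg, ← mul_assoc, hJ, one_mul]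
  module

/-- Multiplication by `exp (lam * u)` turns the `lam`-slice Cauchy–Riemann equation into the slice
Cauchy–Riemann equation. -/
lemma fderiv_exp_smul_slice {e : Fin n → Cl} {lam : ℝ} {f : Pt n → Cl} {x : Fin n → ℝ} {p : ℝ × ℝ}
    (hd : DifferentiableAt ℝ (fun q : ℝ × ℝ => f (q.1, q.2 • x)) p)
    (hCR : sliceCR e f x p.1 p.2 + lam • f (p.1, p.2 • x) = 0) :
    fderiv ℝ (fun q : ℝ × ℝ => Real.exp (lam * q.1) • f (q.1, q.2 • x)) p (1, 0) +
      vecEmb e x *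
        fderiv ℝ (fun q : ℝ × ℝ => Real.exp (lam * q.1) • f (q.1, q.2 • x)) p (0, 1) = 0 := by
  have hu : deriv (fun t => f (t, p.2 • x)) p.1 =
      fderiv ℝ (fun q : ℝ × ℝ => f (q.1, q.2 • x)) p (1, 0) :=
    (HasFDerivAt.comp_hasDerivAt (l := fun q : ℝ × ℝ => f (q.1, q.2 • x)) p.1 hd.hasFDerivAt
      ((hasDerivAt_id p.1).prodMk (hasDerivAt_const p.1 p.2))).deriv
  have hv : deriv (fun t => f (p.1, t • x)) p.2 =
      fderiv ℝ (fun q : ℝ × ℝ => f (q.1, q.2 • x)) p (0, 1) :=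
    (HasFDerivAt.comp_hasDerivAt (l := fun q : ℝ × ℝ => f (q.1, q.2 • x)) p.2 hd.hasFDerivAt
      ((hasDerivAt_const p.2 p.1).prodMk (hasDerivAt_id p.2))).deriv
  rw [sliceCR, hu, hv] at hCR
  have hexp : HasFDerivAt (fun q : ℝ × ℝ => Real.exp (lam * q.1))
      (Real.exp (lam * p.1) • lam • ContinuousLinearMap.fst ℝ ℝ ℝ) p :=
    ((hasFDerivAt_fst (𝕜 := ℝ) (E := ℝ) (F := ℝ)).const_mul lam).exp
  rw [(hexp.fun_smul hd.hasFDerivAt).fderiv]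
  calc _ = Real.exp (lam * p.1) • (fderiv ℝ (fun q : ℝ × ℝ => f (q.1, q.2 • x)) p (1, 0) +
        vecEmb e x * fderiv ℝ (fun q : ℝ × ℝ => f (q.1, q.2 • x)) p (0, 1) +
        lam • f (p.1, p.2 • x)) := by
        simp
        module
    _ = 0 := by rw [hCR, smul_zero]

/-- Cauchy theorem for λ-slice monogenic functions. -/
theorem statement5 [CompleteSpace Cl] (e : Fin n → Cl) (he : CliffordRel e) (lam : ℝ)
    (U : Set (Pt n)) (hU : AxSymSDomain n U) (f : Pt n → Cl) (hf : SMlam e lam U f)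
    (x : Fin n → ℝ) (hx : x ∈ USphere n)
    (γ : ℝ → ℝ × ℝ) (hγ : PiecewiseC1 γ)
    (hγ0 : NullHomotopicIn γ (SlicePre n U x)) :
    ∫ t in (0:ℝ)..1,
      Real.exp (lam * (γ t).1) •
        (((deriv γ t).1 • (1 : Cl) + (deriv γ t).2 • vecEmb e x) *
          (-(vecEmb e x)) * f ((γ t).1, (γ t).2 • x)) = 0 := by
  have hJ := he.vecEmb_mul_self hx
  set J := vecEmb e x
  obtain ⟨hfC, hCR⟩ := hf
  have hφ : ContDiff ℝ 1 fun p : ℝ × ℝ => ((p.1, p.2 • x) : Pt n) := by fun_prop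
  have hV : IsOpen (SlicePre n U x) := hU.1.preimage hφ.continuous
  set g : ℝ × ℝ → Cl := fun p => Real.exp (lam * p.1) • f (p.1, p.2 • x) with hg
  have hslice : ∀ p ∈ SlicePre n U x,
      DifferentiableAt ℝ (fun p : ℝ × ℝ => f (p.1, p.2 • x)) p := fun p hp =>
    ((hfC.differentiableOn one_ne_zero).differentiableAt (hU.1.mem_nhds hp)).comp p
      (hφ.differentiable one_ne_zero p)
  have hgd : ∀ p ∈ SlicePre n U x, DifferentiableAt ℝ g p := fun p hp =>
    DifferentiableAt.fun_smul (by fun_prop) (hslice p hp)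
  have hgCR : ∀ p ∈ SlicePre n U x, fderiv ℝ g p (1, 0) + J * fderiv ℝ g p (0, 1) = 0 :=
    fun p hp => fderiv_exp_smul_slice (hslice p hp) (hCR x hx p.1 p.2 hp)
  have hωd : DifferentiableOn ℝ (sliceForm J g) (SlicePre n U x) := fun p hp =>
    (hgd p hp).hasFDerivAt.sliceForm.differentiableAt.differentiableWithinAt
  obtain ⟨s, hs, hd⟩ := hγ.exists_countable_differentiableAt
  obtain ⟨-, hγV, H, p, hH, hHV, hH0, hH1, hHcl⟩ := hγ0
  have hint := hγ.intervalIntegrable_clm_deriv (hωd.continuousOn.comp hγ.1 hγV)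
  rw [← integral_closed_form_eq_zero_of_homotopy hV hωd
    (fun p hp => fderiv_sliceForm_symmetric hJ (hgd p hp) (hgCR p hp)) hs hγ.1 hd hint hH hHV
    hH0 hH1 hHcl]
  refine intervalIntegral.integral_congr fun t _ => ?_
  simp only [sliceForm_apply, hg, add_mul, smul_mul_assoc, one_mul, mul_neg, neg_mul, hJ,
    mul_smul_comm]
  module
end
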